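/- arXiv:2206.00444 — 2 statements merged into one kernel-verified Lean document; each statement's English description precedes it below -/
import Mathlib

section
/- Let X ↪ Y be a minimal sectional monomorphism between indecomposable rigid bricks over the path algebra of a Dynkin quiver, with Hom(X,Y) one-dimensional, Hom(Y,X) = 0, and Ext¹(X,Y) = Ext¹(Y,X) = 0. Set S := Y/X. Then: Hom(X,S) = 0, Hom(S,X) = 0, Hom(Y,S) is one-dimensional, Hom(S,Y) = 0, dim Ext¹(S,X) = 1, Ext¹(X,S) = 0, Ext¹(Y,S) = Ext¹(S,Y) = 0, S is a brick (End(S) ≅ K), and Ext¹(S,S) = 0 (S is rigid). -/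
/-!
STATEMENT 13: Let `X ↪ Y` be a (minimal sectional) monomorphism between indecomposable
rigid bricks over the (hereditary) path algebra of a Dynkin quiver, with `Hom(X,Y)`
one-dimensional, `Hom(Y,X) = 0`, and `Ext¹(X,Y) = Ext¹(Y,X) = 0`. Set `S := Y/X`. Then:
`Hom(X,S) = 0`, `Hom(S,X) = 0`, `Hom(Y,S)` is one-dimensional, `Hom(S,Y) = 0`,
`dim Ext¹(S,X) = 1`, `Ext¹(X,S) = 0`, `Ext¹(Y,S) = Ext¹(S,Y) = 0`, `S` is a brick,
and `Ext¹(S,S) = 0`.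
-/

open CategoryTheory

/-- Abbreviation for the first Ext group of `A`-modules as a `k`-module. -/
noncomputable abbrev Ext1 (k : Type) [Field k] (A : Type) [Ring A] [Algebra k A]
    (M N : ModuleCat.{0} A) : ModuleCat k :=
  ((Ext k (ModuleCat.{0} A) 1).obj (Opposite.op M)).obj N

section Comparison

universe w v u t

variable {R : Type t} [Ring R] {C : Type u} [Category.{v} C] [Abelian C] [Linear R C]

namespace CategoryTheory.ProjectiveResolution

variable {M N : C} (P : ProjectiveResolution M)

/-- Sending a cocycle to its class in `Abelian.Ext`, as a linear map. -/
noncomputable def cocycleToExt [HasExt.{w} C] (n : ℕ) :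
    LinearMap.ker (Linear.leftComp R N (P.complex.d (n + 1) n)) →ₗ[R] Abelian.Ext.{w} M N n where
  toFun f := P.extMk f.1 (n + 1) rfl f.2
  map_add' f g := (P.add_extMk f.1 g.1 (n + 1) rfl f.2 g.2).symm
  map_smul' r f := by
    refine Eq.trans ?_ (Abelian.Ext.smul_eq_comp_mk₀ _ r).symm
    refine Eq.trans ?_ (P.extMk_comp_mk₀ f.1 (n + 1) rfl f.2 (r • 𝟙 N)).symm
    congr 1
    simp

lemma cocycleToExt_surjective [HasExt.{w} C] (n : ℕ) :
    Function.Surjective (P.cocycleToExt (R := R) (N := N) n) := by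
  intro α
  obtain ⟨f, hf, rfl⟩ := P.extMk_surjective α (n + 1) rfl
  exact ⟨⟨f, hf⟩, rfl⟩

/-- `Abelian.Ext` agrees with the cohomology of the complex of morphisms out of a projective
resolution. -/
noncomputable def homologyLinearEquivExt [HasExt.{w} C] (n : ℕ) :
    (P.complex.linearYonedaObj R N).homology (n + 1) ≃ₗ[R] Abelian.Ext.{w} M N (n + 1) :=
  let K := P.complex.linearYonedaObj R N
  (K.homologyIsoSc' n (n + 1) (n + 2) (by simp) (by simp) ≪≫
    (K.sc' n (n + 1) (n + 2)).moduleCatHomologyIso).toLinearEquiv ≪≫ₗ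
  Submodule.quotEquivOfEq _ (LinearMap.ker (P.cocycleToExt (R := R) (N := N) (n + 1)))
    (Submodule.ext fun f => (exists_congr fun g => Subtype.ext_iff).trans
      (P.extMk_eq_zero_iff f.1 (n + 2) rfl f.2 n rfl).symm) ≪≫ₗ
  LinearMap.quotKerEquivOfSurjective _ (P.cocycleToExt_surjective (n + 1))

end CategoryTheory.ProjectiveResolution

/-- The two definitions of `Ext` groups in Mathlib agree in positive degrees. -/
noncomputable def extLinearEquiv [EnoughProjectives C] [HasExt.{w} C] (M N : C) (n : ℕ) :
    ((Ext R C (n + 1)).obj (Opposite.op M)).obj N ≃ₗ[R] Abelian.Ext.{w} M N (n + 1) :=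
  ((ProjectiveResolution.of M).isoExt (n + 1) N).toLinearEquiv ≪≫ₗ
    (ProjectiveResolution.of M).homologyLinearEquivExt n

end Comparison

section ShortExact

universe w v u t

open Abelian.Ext

variable {C : Type u} [Category.{v} C] [Abelian C] [HasExt.{w} C]
  {S : ShortComplex C}

namespace CategoryTheory.ShortComplex.ShortExact

lemma exists_comp_g_eq (hS : S.ShortExact) (W : C) [Subsingleton (Abelian.Ext.{w} W S.X₁ 1)]
    (f : W ⟶ S.X₃) :
    ∃ h : W ⟶ S.X₂, h ≫ S.g = f := by
  obtain ⟨x, hx⟩ := covariant_sequence_exact₃ W hS (mk₀ f) (zero_add 1) (Subsingleton.elim _ _)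
  obtain ⟨h, rfl⟩ := (mk₀_bijective W S.X₂).2 x
  exact ⟨h, (mk₀_bijective W S.X₃).1 (by simpa using hx)⟩

lemma subsingleton_ext_X₃_right (hS : S.ShortExact) (W : C) (n : ℕ)
    [Subsingleton (Abelian.Ext.{w} W S.X₂ n)]
    [Subsingleton (Abelian.Ext.{w} W S.X₁ (n + 1))] : Subsingleton (Abelian.Ext.{w} W S.X₃ n) := by
  refine subsingleton_of_forall_eq 0 fun x => ?_
  obtain ⟨y, rfl⟩ := covariant_sequence_exact₃ W hS x rfl (Subsingleton.elim _ _)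
  rw [Subsingleton.elim y 0, zero_comp]

lemma subsingleton_ext_one_X₃_left (hS : S.ShortExact) (W : C)
    [Subsingleton (Abelian.Ext.{w} S.X₂ W 1)]
    (h : ∀ f : S.X₁ ⟶ W, ∃ g : S.X₂ ⟶ W, S.f ≫ g = f) :
    Subsingleton (Abelian.Ext.{w} S.X₃ W 1) := by
  refine subsingleton_of_forall_eq 0 fun x => ?_
  obtain ⟨y, rfl⟩ :=
    contravariant_sequence_exact₃ hS W x (Subsingleton.elim _ _) (add_zero 1)
  obtain ⟨f, rfl⟩ := (mk₀_bijective S.X₁ W).2 y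
  obtain ⟨g, rfl⟩ := h f
  rw [← mk₀_comp_mk₀, ShortComplex.ShortExact.extClass_comp_assoc]

variable (hS : S.ShortExact) (k : Type t) [CommRing k] [Linear k C]

/-- Composition with `S.g` identifies `W ⟶ S.X₂` with `W ⟶ S.X₃` when `W` has neither morphisms
nor extensions to `S.X₁`. -/
noncomputable def homLinearEquivRight (W : C) [Subsingleton (W ⟶ S.X₁)]
    [Subsingleton (Abelian.Ext.{w} W S.X₁ 1)] : (W ⟶ S.X₂) ≃ₗ[k] (W ⟶ S.X₃) :=
  LinearEquiv.ofBijective (Linear.rightComp k W S.g) (by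
    refine ⟨(injective_iff_map_eq_zero _).2 fun f hf => ?_, hS.exists_comp_g_eq W⟩
    have := hS.mono_f
    obtain ⟨l, rfl⟩ : ∃ l, l ≫ S.f = f := ⟨hS.exact.lift f hf, hS.exact.lift_f f hf⟩
    rw [Subsingleton.elim l 0, Limits.zero_comp])

/-- Composition with `S.g` identifies `S.X₃ ⟶ W` with `S.X₂ ⟶ W` when there are no morphisms
from `S.X₁` to `W`. -/
noncomputable def homLinearEquivLeft (W : C) [Subsingleton (S.X₁ ⟶ W)] :
    (S.X₃ ⟶ W) ≃ₗ[k] (S.X₂ ⟶ W) :=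
  LinearEquiv.ofBijective (Linear.leftComp k W S.g) (by
    have := hS.epi_g
    refine ⟨fun f f' h => (cancel_epi S.g).1 h, fun f => ?_⟩
    exact ⟨hS.exact.desc f (Subsingleton.elim _ _), hS.exact.g_desc f _⟩)

/-- The connecting map identifies `S.X₁ ⟶ W` with the extensions of `S.X₃` by `W` when `S.X₂` has
neither morphisms nor extensions to `W`. -/
noncomputable def homLinearEquivExtOne (W : C) [Subsingleton (S.X₂ ⟶ W)]
    [Subsingleton (Abelian.Ext.{w} S.X₂ W 1)] : (S.X₁ ⟶ W) ≃ₗ[k] Abelian.Ext.{w} S.X₃ W 1 :=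
  (linearEquiv₀ (R := k)).symm ≪≫ₗ
    LinearEquiv.ofBijective (hS.extClass.precompOfLinear k W (add_zero 1)) (by
      refine ⟨(injective_iff_map_eq_zero _).2 fun x hx => ?_, fun x =>
        contravariant_sequence_exact₃ hS W x (Subsingleton.elim _ _) (add_zero 1)⟩
      obtain ⟨y, rfl⟩ := contravariant_sequence_exact₁ hS W x (add_zero 1) hx
      obtain ⟨f, rfl⟩ := (mk₀_bijective S.X₂ W).2 y
      rw [Subsingleton.elim f 0, mk₀_zero, comp_zero])

end CategoryTheory.ShortComplex.ShortExact

/-- The table of `Hom` and `Ext` spaces for a short exact sequence in a linear abelian category. -/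
theorem hom_ext_table_of_shortExact {k : Type*} [Field k] {C : Type*} [Category* C] [Abelian C]
    [Linear k C] [HasExt.{w} C] {S : ShortComplex C} (hS : S.ShortExact)
    (hbr₁ : Module.finrank k (S.X₁ ⟶ S.X₁) = 1) (hbr₂ : Module.finrank k (S.X₂ ⟶ S.X₂) = 1)
    (hhom : Module.finrank k (S.X₁ ⟶ S.X₂) = 1) [Subsingleton (S.X₂ ⟶ S.X₁)]
    [Subsingleton (Abelian.Ext.{w} S.X₁ S.X₁ 1)] [Subsingleton (Abelian.Ext.{w} S.X₂ S.X₂ 1)]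
    [Subsingleton (Abelian.Ext.{w} S.X₁ S.X₂ 1)] [Subsingleton (Abelian.Ext.{w} S.X₂ S.X₁ 1)]
    [Subsingleton (Abelian.Ext.{w} S.X₁ S.X₁ 2)] [Subsingleton (Abelian.Ext.{w} S.X₂ S.X₁ 2)] :
    Subsingleton (S.X₁ ⟶ S.X₃) ∧
    Subsingleton (S.X₃ ⟶ S.X₁) ∧
    Module.finrank k (S.X₂ ⟶ S.X₃) = 1 ∧
    Subsingleton (S.X₃ ⟶ S.X₂) ∧
    Module.finrank k (Abelian.Ext.{w} S.X₃ S.X₁ 1) = 1 ∧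
    Subsingleton (Abelian.Ext.{w} S.X₁ S.X₃ 1) ∧
    Subsingleton (Abelian.Ext.{w} S.X₂ S.X₃ 1) ∧
    Subsingleton (Abelian.Ext.{w} S.X₃ S.X₂ 1) ∧
    Module.finrank k (S.X₃ ⟶ S.X₃) = 1 ∧
    Subsingleton (Abelian.Ext.{w} S.X₃ S.X₃ 1) := by
  have := hS.mono_f
  have := hS.epi_g
  have hf : S.f ≠ 0 := by
    intro h
    have : 𝟙 S.X₁ = 0 := (cancel_mono S.f).1 (by simp [h])
    have : Subsingleton (S.X₁ ⟶ S.X₁) :=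
      ⟨((Limits.IsZero.iff_id_eq_zero _).2 this).eq_of_src⟩
    exact zero_ne_one ((Module.finrank_zero_of_subsingleton (R := k)).symm.trans hbr₁)
  have smul_f (h : S.X₁ ⟶ S.X₂) : ∃ c : k, c • S.f = h :=
    (finrank_eq_one_iff_of_nonzero' S.f hf).1 hhom h
  have hom₁₃ : Subsingleton (S.X₁ ⟶ S.X₃) := by
    refine subsingleton_of_forall_eq 0 fun x => ?_
    obtain ⟨h, rfl⟩ := hS.exists_comp_g_eq S.X₁ x
    obtain ⟨c, rfl⟩ := smul_f h
    simp
  have hom₃₂ : Subsingleton (S.X₃ ⟶ S.X₂) := by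
    refine subsingleton_of_forall_eq 0 fun x => ?_
    have hid : 𝟙 S.X₂ ≠ 0 := fun h => hf (by rw [← Category.comp_id S.f, h, Limits.comp_zero])
    obtain ⟨c, hc⟩ := (finrank_eq_one_iff_of_nonzero' (𝟙 S.X₂) hid).1 hbr₂ (S.g ≫ x)
    have hcf : c • S.f = 0 := by
      rw [← Category.comp_id S.f, ← Linear.comp_smul, hc, S.zero_assoc, Limits.zero_comp]
    rw [(smul_eq_zero.1 hcf).resolve_right hf, zero_smul] at hc
    exact (cancel_epi S.g).1 (by rw [← hc, Limits.comp_zero])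
  have ext₁₃ := hS.subsingleton_ext_X₃_right S.X₁ 1
  have ext₂₃ := hS.subsingleton_ext_X₃_right S.X₂ 1
  refine ⟨hom₁₃, ⟨fun _ _ => (cancel_epi S.g).1 (Subsingleton.elim _ _)⟩, ?_,
    hom₃₂, ?_, ext₁₃, ext₂₃, ?_, ?_, ?_⟩
  · rw [← (hS.homLinearEquivRight k S.X₂).finrank_eq, hbr₂]
  · rw [← (hS.homLinearEquivExtOne k S.X₁).finrank_eq, hbr₁]
  · refine hS.subsingleton_ext_one_X₃_left S.X₂ fun h => ?_
    obtain ⟨c, rfl⟩ := smul_f h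
    exact ⟨c • 𝟙 S.X₂, by simp⟩
  · rw [(hS.homLinearEquivLeft k S.X₃).finrank_eq,
      ← (hS.homLinearEquivRight k S.X₂).finrank_eq, hbr₂]
  · exact hS.subsingleton_ext_one_X₃_left S.X₃ fun h => ⟨0, Subsingleton.elim _ _⟩

end ShortExact

theorem hom_ext_table_of_minimal_sectional_mono
    (k : Type) [Field k] [IsAlgClosed k]
    (A : Type) [Ring A] [Algebra k A] [FiniteDimensional k A]
    -- `A` is hereditary: all second Ext groups vanish
    (hhered : ∀ M N : ModuleCat.{0} A,
      Subsingleton (((Ext k (ModuleCat.{0} A) 2).obj (Opposite.op M)).obj N))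
    (X Y : Type)
    [AddCommGroup X] [Module A X] [Module.Finite A X]
    [AddCommGroup Y] [Module A Y] [Module.Finite A Y]
    -- X and Y are bricks
    (hbrX : Module.finrank k (ModuleCat.of A X ⟶ ModuleCat.of A X) = 1)
    (hbrY : Module.finrank k (ModuleCat.of A Y ⟶ ModuleCat.of A Y) = 1)
    -- X and Y are rigid
    (hrigX : Subsingleton (Ext1 k A (ModuleCat.of A X) (ModuleCat.of A X)))
    (hrigY : Subsingleton (Ext1 k A (ModuleCat.of A Y) (ModuleCat.of A Y)))
    -- Hom(X,Y) is one-dimensional, Hom(Y,X) = 0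
    (hXY : Module.finrank k (ModuleCat.of A X ⟶ ModuleCat.of A Y) = 1)
    (hYX : Subsingleton (ModuleCat.of A Y ⟶ ModuleCat.of A X))
    -- Ext¹(X,Y) = Ext¹(Y,X) = 0
    (hext1XY : Subsingleton (Ext1 k A (ModuleCat.of A X) (ModuleCat.of A Y)))
    (hext1YX : Subsingleton (Ext1 k A (ModuleCat.of A Y) (ModuleCat.of A X)))
    -- a fixed injection X ↪ Y with cokernel S
    (ι : X →ₗ[A] Y) (hι : Function.Injective ι) :
    let S : ModuleCat.{0} A := ModuleCat.of A (Y ⧸ LinearMap.range ι)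
    Subsingleton (ModuleCat.of A X ⟶ S) ∧
    Subsingleton (S ⟶ ModuleCat.of A X) ∧
    Module.finrank k (ModuleCat.of A Y ⟶ S) = 1 ∧
    Subsingleton (S ⟶ ModuleCat.of A Y) ∧
    Module.finrank k (Ext1 k A S (ModuleCat.of A X)) = 1 ∧
    Subsingleton (Ext1 k A (ModuleCat.of A X) S) ∧
    Subsingleton (Ext1 k A (ModuleCat.of A Y) S) ∧
    Subsingleton (Ext1 k A S (ModuleCat.of A Y)) ∧
    Module.finrank k (S ⟶ S) = 1 ∧
    Subsingleton (Ext1 k A S S) := by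
  intro S
  let T : ShortComplex (ModuleCat.{0} A) :=
    ShortComplex.mk (ModuleCat.ofHom ι) (ModuleCat.ofHom (LinearMap.range ι).mkQ) (by
      ext x
      exact (Submodule.Quotient.mk_eq_zero _).2 ⟨x, rfl⟩)
  have hT : T.ShortExact :=
    { exact := (ShortComplex.moduleCat_exact_iff T).2 fun x hx =>
        (Submodule.Quotient.mk_eq_zero _).1 hx
      mono_f := (ModuleCat.mono_iff_injective _).2 hι
      epi_g := (ModuleCat.epi_iff_surjective _).2 (Submodule.mkQ_surjective _) }
  have : Subsingleton (T.X₂ ⟶ T.X₁) := hYX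
  have ext {M N : ModuleCat.{0} A} {n : ℕ}
      (h : Subsingleton (((Ext k (ModuleCat.{0} A) (n + 1)).obj (Opposite.op M)).obj N)) :
      Subsingleton (Abelian.Ext.{0} M N (n + 1)) :=
    (extLinearEquiv (R := k) M N n).symm.subsingleton
  have : Subsingleton (Abelian.Ext.{0} T.X₁ T.X₁ 1) := ext hrigX
  have : Subsingleton (Abelian.Ext.{0} T.X₂ T.X₂ 1) := ext hrigY
  have : Subsingleton (Abelian.Ext.{0} T.X₁ T.X₂ 1) := ext hext1XY
  have : Subsingleton (Abelian.Ext.{0} T.X₂ T.X₁ 1) := ext hext1YX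
  have : Subsingleton (Abelian.Ext.{0} T.X₁ T.X₁ 2) := ext (hhered _ _)
  have : Subsingleton (Abelian.Ext.{0} T.X₂ T.X₁ 2) := ext (hhered _ _)
  obtain ⟨h₁, h₂, h₃, h₄, h₅, h₆, h₇, h₈, h₉, h₁₀⟩ :=
    hom_ext_table_of_shortExact hT hbrX hbrY hXY
  exact ⟨h₁, h₂, h₃, h₄, (extLinearEquiv _ _ 0).finrank_eq.trans h₅,
    (extLinearEquiv _ _ 0).subsingleton, (extLinearEquiv _ _ 0).subsingleton,
    (extLinearEquiv _ _ 0).subsingleton, h₉, (extLinearEquiv _ _ 0).subsingleton⟩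
end

section
/- Let 0 → X →ι Y →π S → 0 be a non-split short exact sequence over a hereditary algebra with dim Ext¹(S,X) = 1, such that X ↪ Y is a minimal sectional mono (meaning: every indecomposable summand Y'_i of a module Y' sitting in a pullback as below is isomorphic to X, to Y, or receives the zero map from X). Then for every proper nonzero subrepresentation N ⊊ S, the pullback extension 0 → X → Y' → N → 0 along N ↪ S splits. Consequently S^X := max{ M ⊆ S : dim Ext¹(M, X) = 1 } equals S. -/
/-!
STATEMENT 14: Let `0 → X →ι Y →π S → 0` be a non-split short exact sequence over a
hereditary algebra with `dim Ext¹(S,X) = 1`, such that `X ↪ Y` is a minimal sectional mono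
(meaning: every indecomposable summand of a module `Y'` sitting in a pullback of the
sequence along `N ↪ S` is isomorphic to `X`, to `Y`, or receives the zero map from `X`).
Then for every proper nonzero subrepresentation `N ⊊ S`, the pullback extension
`0 → X → Y' → N → 0` along `N ↪ S` splits. Consequently
`S^X := max{ M ⊆ S : dim Ext¹(M, X) = 1 }` equals `S`.
-/

open CategoryTheory

def IsIndecomposableModule (R M : Type) [Ring R] [AddCommGroup M] [Module R M] : Prop :=
  Nontrivial M ∧ ∀ p q : Submodule R M, IsCompl p q → p = ⊥ ∨ q = ⊥

section Pullback

variable {A X Y S : Type} [Ring A]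
  [AddCommGroup X] [Module A X] [AddCommGroup Y] [Module A Y]
  [AddCommGroup S] [Module A S]

/-- The pullback `Y' = Y ×_S N` of `π : Y → S` along the inclusion of `N ⊆ S`,
realized as a submodule of `Y × N`. -/
def pullbackAlong (π : Y →ₗ[A] S) (N : Submodule A S) : Submodule A (Y × N) :=
  LinearMap.ker ((π.comp (LinearMap.fst A Y N)) - (N.subtype.comp (LinearMap.snd A Y N)))

/-- The canonical map `X → Y ×_S N`, `x ↦ (ι x, 0)`. -/
noncomputable def intoPullback (ι : X →ₗ[A] Y) (π : Y →ₗ[A] S)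
    (hexact : LinearMap.range ι = LinearMap.ker π) (N : Submodule A S) :
    X →ₗ[A] ↥(pullbackAlong π N) :=
  LinearMap.codRestrict (pullbackAlong π N) (LinearMap.prod ι 0) (by
    intro x
    have hx : π (ι x) = 0 := by
      have : ι x ∈ LinearMap.ker π := hexact ▸ LinearMap.mem_range_self ι x
      simpa using this
    simp [pullbackAlong, LinearMap.mem_ker, hx])

end Pullback

section Indecomposable

variable {A X M : Type} [Ring A] [AddCommGroup X] [Module A X] [AddCommGroup M] [Module A M]

/-- **Fitting's lemma**: a non-injective endomorphism of an indecomposable module of finite length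
is nilpotent. -/
theorem IsIndecomposableModule.isNilpotent_of_not_injective [IsArtinian A X] [IsNoetherian A X]
    (hX : IsIndecomposableModule A X) {f : Module.End A X} (hf : ¬ Function.Injective f) :
    IsNilpotent f := by
  obtain ⟨n, hc, hn⟩ :=
    ((LinearMap.eventually_isCompl_ker_pow_range_pow f).and
      (Filter.eventually_ge_atTop 1)).exists
  refine ⟨n, ?_⟩
  rcases hX.2 _ _ hc with h | h
  · refine absurd ?_ hf
    obtain ⟨m, rfl⟩ := Nat.exists_eq_add_of_le' hn
    rw [LinearMap.ker_eq_bot, pow_succ, Module.End.mul_eq_comp, LinearMap.coe_comp] at h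
    exact h.of_comp
  · exact LinearMap.range_eq_bot.mp h

/-- A finite-dimensional indecomposable module has a nonzero element that is killed by every
non-injective endomorphism. -/
theorem IsIndecomposableModule.exists_ne_zero_forall_not_injective (k : Type) [Field k]
    [Algebra k A] [FiniteDimensional k A] [Module.Finite A X]
    (hX : IsIndecomposableModule A X) :
    ∃ w : X, w ≠ 0 ∧ ∀ f : Module.End A X, ¬ Function.Injective f → f w = 0 := by
  let : Module k X := Module.compHom X (algebraMap k A)
  have : IsScalarTower k A X := ⟨fun c a x ↦ by
    rw [Algebra.smul_def, mul_smul]; rfl⟩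
  have : SMulCommClass A k X := IsScalarTower.to_smulCommClass' (R := k)
  have : IsArtinianRing A := IsArtinianRing.of_finite k A
  have : IsNoetherianRing A := IsNoetherianRing.of_finite k A
  have : Module.Finite k X := Module.Finite.trans A X
  have : IsArtinian (Module.End A X) X := isArtinian_of_tower k inferInstance
  have : Nontrivial X := hX.1
  obtain ⟨W, hW⟩ := IsAtomic.exists_atom (Submodule (Module.End A X) X)
  obtain ⟨w, hwW, hw⟩ := W.ne_bot_iff.mp hW.1
  refine ⟨w, hw, fun f hf ↦ ?_⟩
  by_contra hfw
  have hspan : Submodule.span (Module.End A X) {f w} = W :=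
    (hW.le_iff.mp <| (Submodule.span_singleton_le_iff_mem _ _).mpr
      (W.smul_mem f hwW)).resolve_left (by simpa using hfw)
  obtain ⟨h, hh⟩ := Submodule.mem_span_singleton.mp (hspan ▸ hwW)
  have hfix : (h * f) w = w := hh
  obtain ⟨n, hn⟩ := hX.isNilpotent_of_not_injective (f := h * f) fun hinj ↦ by
    rw [Module.End.mul_eq_comp, LinearMap.coe_comp] at hinj
    exact hf hinj.of_comp
  refine hw ?_
  rw [← Function.iterate_fixed hfix n, ← Module.End.coe_pow, hn, LinearMap.zero_apply]

/-- In an artinian module, an element whose component in each indecomposable direct summand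
vanishes is zero. -/
theorem eq_zero_of_forall_indecomposable_summand [IsArtinian A M] (m : M)
    (h : ∀ Z Z' : Submodule A M, IsCompl Z Z' → IsIndecomposableModule A Z → m ∈ Z') :
    m = 0 := by
  suffices H : ∀ Z Z' : Submodule A M, IsCompl Z Z' → m ∈ Z' by
    simpa using H ⊤ ⊥ isCompl_top_bot
  intro Z
  induction Z using WellFoundedLT.induction with
  | _ Z ih =>
  intro Z' hc
  by_cases hZ : IsIndecomposableModule A Z
  · exact h Z Z' hc hZ
  rcases subsingleton_or_nontrivial Z with hs | hs
  · have hbot : Z = ⊥ := Submodule.subsingleton_iff_eq_bot.mp hs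
    have htop : Z' = ⊤ := by simpa [hbot] using hc.sup_eq_top
    exact htop ▸ Submodule.mem_top
  simp only [IsIndecomposableModule, hs, true_and, not_forall, not_or] at hZ
  obtain ⟨p, q, hpq, hp, hq⟩ := hZ
  have hsup : p.map Z.subtype ⊔ q.map Z.subtype = Z := by
    rw [← Submodule.map_sup, hpq.sup_eq_top, Submodule.map_subtype_top]
  have hdisj : Disjoint (p.map Z.subtype) (q.map Z.subtype) := by
    rw [disjoint_iff, ← Submodule.map_inf _ Z.injective_subtype, hpq.inf_eq_bot,
      Submodule.map_bot]
  generalize hZ₁ : p.map Z.subtype = Z₁ at hsup hdisj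
  generalize hZ₂ : q.map Z.subtype = Z₂ at hsup hdisj
  have hne₁ : Z₁ ≠ ⊥ := fun h0 ↦ hp <|
    Submodule.map_injective_of_injective Z.injective_subtype
      (hZ₁.trans (h0.trans (Submodule.map_bot _).symm))
  have hne₂ : Z₂ ≠ ⊥ := fun h0 ↦ hq <|
    Submodule.map_injective_of_injective Z.injective_subtype
      (hZ₂.trans (h0.trans (Submodule.map_bot _).symm))
  have hlt₁ : Z₁ < Z := by
    rw [← hsup, left_lt_sup]
    exact fun hle ↦ hne₂ (hdisj.symm.eq_bot_of_le hle)
  have hlt₂ : Z₂ < Z := by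
    rw [← hsup, right_lt_sup]
    exact fun hle ↦ hne₁ (hdisj.eq_bot_of_le hle)
  have hc₁ : IsCompl Z₁ (Z₂ ⊔ Z') :=
    ⟨hdisj.disjoint_sup_right_of_disjoint_sup_left (hsup ▸ hc.disjoint), by
      rw [codisjoint_iff, ← sup_assoc, hsup, hc.sup_eq_top]⟩
  have hsup' : Z₂ ⊔ Z₁ = Z := sup_comm Z₁ Z₂ ▸ hsup
  have hc₂ : IsCompl Z₂ (Z₁ ⊔ Z') :=
    ⟨hdisj.symm.disjoint_sup_right_of_disjoint_sup_left (hsup' ▸ hc.disjoint), by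
      rw [codisjoint_iff, ← sup_assoc, hsup', hc.sup_eq_top]⟩
  have hm : m ∈ (Z' ⊔ Z₂) ⊓ (Z₁ ⊔ Z') := ⟨sup_comm Z₂ Z' ▸ ih Z₁ hlt₁ _ hc₁, ih Z₂ hlt₂ _ hc₂⟩
  rwa [sup_inf_assoc_of_le Z₂ (le_sup_right : Z' ≤ Z₁ ⊔ Z'), hc₂.inf_eq_bot, sup_bot_eq] at hm

/-- An injection `f` out of a finite-dimensional indecomposable module `X` has a retraction as soon
as every indecomposable direct summand of the target is isomorphic to `X` or receives the zero
component of `f`. -/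
theorem IsIndecomposableModule.exists_leftInverse (k : Type) [Field k]
    [Algebra k A] [FiniteDimensional k A] [Module.Finite A X] [IsArtinian A M]
    (hX : IsIndecomposableModule A X) {f : X →ₗ[A] M} (hf : Function.Injective f)
    (h : ∀ (Z Z' : Submodule A M) (hc : IsCompl Z Z'), IsIndecomposableModule A Z →
      Nonempty (Z ≃ₗ[A] X) ∨ (Z.projectionOnto Z' hc).comp f = 0) :
    ∃ r : M →ₗ[A] X, r.comp f = LinearMap.id := by
  have : IsArtinianRing A := IsArtinianRing.of_finite k A
  obtain ⟨w, hw, hkill⟩ := hX.exists_ne_zero_forall_not_injective k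
  by_contra hr
  refine hw (hf ?_)
  rw [map_zero]
  refine eq_zero_of_forall_indecomposable_summand (A := A) (f w) fun Z Z' hc hZ ↦ ?_
  rw [← Submodule.projectionOnto_apply_eq_zero_iff hc]
  rcases h Z Z' hc hZ with ⟨⟨e⟩⟩ | h0
  · let u : Module.End A X := e.toLinearMap ∘ₗ Z.projectionOnto Z' hc ∘ₗ f
    have hu : ¬ Function.Injective u := fun hinj ↦ hr <| by
      let v := LinearEquiv.ofBijective u (IsArtinian.bijective_of_injective_endomorphism u hinj)
      exact ⟨v.symm.toLinearMap ∘ₗ e.toLinearMap ∘ₗ Z.projectionOnto Z' hc,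
        LinearMap.ext fun x ↦ v.symm_apply_apply x⟩
    exact e.map_eq_zero_iff.mp (hkill u hu)
  · exact LinearMap.congr_fun h0 w

end Indecomposable

section Pullback

variable {A X Y S : Type} [Ring A]
  [AddCommGroup X] [Module A X] [AddCommGroup Y] [Module A Y]
  [AddCommGroup S] [Module A S]

theorem mem_pullbackAlong {π : Y →ₗ[A] S} {N : Submodule A S} {z : Y × N} :
    z ∈ pullbackAlong π N ↔ π z.1 = z.2 := by
  simp [pullbackAlong, sub_eq_zero]

theorem intoPullback_injective {ι : X →ₗ[A] Y} (hι : Function.Injective ι) (π : Y →ₗ[A] S)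
    (hexact : LinearMap.range ι = LinearMap.ker π) (N : Submodule A S) :
    Function.Injective (intoPullback ι π hexact N) := fun _ _ h ↦
  hι (congrArg (fun z : pullbackAlong π N ↦ z.1.1) h)

/-- The projection of the pullback `Y ×_S N` to `Y`. -/
def pullbackFst (π : Y →ₗ[A] S) (N : Submodule A S) : pullbackAlong π N →ₗ[A] Y :=
  LinearMap.fst A Y N ∘ₗ (pullbackAlong π N).subtype

theorem pullbackFst_injective (π : Y →ₗ[A] S) (N : Submodule A S) :
    Function.Injective (pullbackFst π N) := by
  rintro ⟨⟨y, n⟩, h⟩ ⟨⟨y', n'⟩, h'⟩ (rfl : y = y')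
  rw [mem_pullbackAlong] at h h'
  exact Subtype.ext (Prod.ext rfl (Subtype.ext (h.symm.trans h')))

/-- The whole of `Y` does not embed in the pullback along a proper submodule. -/
theorem not_injective_into_pullbackAlong [IsArtinian A Y] {π : Y →ₗ[A] S}
    (hπ : Function.Surjective π) {N : Submodule A S} (hN : N ≠ ⊤)
    (g : Y →ₗ[A] pullbackAlong π N) : ¬ Function.Injective g := fun hg ↦ hN <| by
  have hsurj := IsArtinian.surjective_of_injective_endomorphism (pullbackFst π N ∘ₗ g)
    ((pullbackFst_injective π N).comp hg)
  refine eq_top_iff.mpr fun s _ ↦ ?_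
  obtain ⟨y, rfl⟩ := hπ s
  obtain ⟨y', rfl⟩ := hsurj y
  have := mem_pullbackAlong.mp (g y').2
  exact (show π (g y').1.1 ∈ N from this ▸ (g y').1.2.2)

/-- A retraction of `X → Y ×_S N` yields a lift of the inclusion `N ⊆ S` through `π`. -/
theorem exists_lift_of_leftInverse {ι : X →ₗ[A] Y} {π : Y →ₗ[A] S} (hπ : Function.Surjective π)
    (hexact : LinearMap.range ι = LinearMap.ker π) {N : Submodule A S}
    {r : pullbackAlong π N →ₗ[A] X}
    (hr : r.comp (intoPullback ι π hexact N) = LinearMap.id) :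
    ∃ θ : N →ₗ[A] Y, ∀ n : N, π (θ n) = n := by
  have hπι (x : X) : π (ι x) = 0 :=
    LinearMap.mem_ker.mp (hexact ▸ LinearMap.mem_range_self ι x)
  let q : pullbackAlong π N →ₗ[A] N := LinearMap.snd A Y N ∘ₗ (pullbackAlong π N).subtype
  have hq : Function.Surjective q := fun n ↦ by
    obtain ⟨y, hy⟩ := hπ n
    exact ⟨⟨(y, n), mem_pullbackAlong.mpr hy⟩, rfl⟩
  let φ : pullbackAlong π N →ₗ[A] Y := pullbackFst π N - ι ∘ₗ r
  have hφ : LinearMap.ker q ≤ LinearMap.ker φ := by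
    rintro ⟨⟨y, n⟩, h⟩ (rfl : n = 0)
    have hy : y ∈ LinearMap.range ι := hexact ▸ mem_pullbackAlong.mp h
    obtain ⟨x, rfl⟩ := hy
    have hrx : r ⟨(ι x, 0), h⟩ = x := LinearMap.congr_fun hr x
    simp [φ, pullbackFst, hrx]
  refine ⟨(LinearMap.ker q).liftQ φ hφ ∘ₗ (q.quotKerEquivOfSurjective hq).symm.toLinearMap,
    fun n ↦ ?_⟩
  obtain ⟨z, rfl⟩ := hq n
  have hz : (q.quotKerEquivOfSurjective hq).symm (q z) = (LinearMap.ker q).mkQ z :=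
    (q.quotKerEquivOfSurjective hq).symm_apply_eq.mpr rfl
  rw [LinearMap.comp_apply, LinearEquiv.coe_coe, hz, Submodule.mkQ_apply, Submodule.liftQ_apply]
  simpa [φ, pullbackFst, hπι, q] using mem_pullbackAlong.mp z.2

end Pullback

theorem pullback_splits_of_minimal_sectional_mono
    (k : Type) [Field k] [IsAlgClosed k]
    (A : Type) [Ring A] [Algebra k A] [FiniteDimensional k A]
    -- `A` is hereditary: all second Ext groups vanish
    (hhered : ∀ M N : ModuleCat.{0} A,
      Subsingleton (((Ext k (ModuleCat.{0} A) 2).obj (Opposite.op M)).obj N))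
    (X Y S : Type)
    [AddCommGroup X] [Module A X] [Module.Finite A X]
    [AddCommGroup Y] [Module A Y] [Module.Finite A Y]
    [AddCommGroup S] [Module A S] [Module.Finite A S]
    (hXind : IsIndecomposableModule A X) (hYind : IsIndecomposableModule A Y)
    (ι : X →ₗ[A] Y) (π : Y →ₗ[A] S)
    (hι : Function.Injective ι) (hπ : Function.Surjective π)
    (hexact : LinearMap.range ι = LinearMap.ker π)
    -- the sequence does not split
    (hnonsplit : ¬ ∃ σ : S →ₗ[A] Y, π.comp σ = LinearMap.id)
    -- dim Ext¹(S, X) = 1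
    (hdim : Module.finrank k (((Ext k (ModuleCat.{0} A) 1).obj
      (Opposite.op (ModuleCat.of A S))).obj (ModuleCat.of A X)) = 1)
    -- minimal sectional mono: every indecomposable direct summand of a pullback
    -- is isomorphic to X, to Y, or receives the zero map from X
    (hmin : ∀ (N : Submodule A S) (Z Z' : Submodule A ↥(pullbackAlong π N))
      (hc : IsCompl Z Z'), IsIndecomposableModule A ↥Z →
      Nonempty (↥Z ≃ₗ[A] X) ∨ Nonempty (↥Z ≃ₗ[A] Y) ∨
        (Z.linearProjOfIsCompl Z' hc).comp (intoPullback ι π hexact N) = 0) :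
    (∀ N : Submodule A S, N ≠ ⊥ → N ≠ ⊤ →
      ∃ θ : ↥N →ₗ[A] Y, ∀ n : ↥N, π (θ n) = ↑n) ∧
    IsGreatest {M : Submodule A S |
      Module.finrank k (((Ext k (ModuleCat.{0} A) 1).obj
        (Opposite.op (ModuleCat.of A ↥M))).obj (ModuleCat.of A X)) = 1} ⊤ := by
  have : IsArtinianRing A := IsArtinianRing.of_finite k A
  refine ⟨fun N _ hN ↦ ?_, ?_, fun _ _ ↦ le_top⟩
  · have : IsArtinian A (pullbackAlong π N) :=
      isArtinian_of_injective _ (pullbackFst_injective π N)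
    obtain ⟨r, hr⟩ := hXind.exists_leftInverse k (intoPullback_injective hι π hexact N)
      fun Z Z' hc hZ ↦ by
        rcases hmin N Z Z' hc hZ with h | ⟨⟨e⟩⟩ | h
        · exact Or.inl h
        · exact absurd (Z.injective_subtype.comp e.symm.injective)
            (not_injective_into_pullbackAlong hπ hN (Z.subtype ∘ₗ e.symm.toLinearMap))
        · exact Or.inr h
    exact exists_lift_of_leftInverse hπ hexact hr
  · let e : ModuleCat.of A (⊤ : Submodule A S) ≅ ModuleCat.of A S :=
      (Submodule.topEquiv (R := A) (M := S)).toModuleIso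
    exact (((Ext k (ModuleCat.{0} A) 1).mapIso e.op).app
      (ModuleCat.of A X)).toLinearEquiv.finrank_eq.symm.trans hdim
end
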